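/- For any restricted-form pushdown automaton P that recognizes a language L, there exists a renormalizing nondeterministic stack RNN (RNS-RNN), with parameters allowed to take values in ℝ ∪ {−∞, +∞}, that recognizes L: the controller emits, at each timestep, weight 1 for exactly the transitions of P that scan the current input symbol and weight 0 for all others, and an MLP layer on the final hidden state after reading w·EOS outputs y > 1/2 iff w ∈ L. -/

import Mathlib

/-- A pushdown automaton `(Q, Σ, Γ, δ, q₀, F, ⊥)` over the input alphabet `α`.
Stacks are lists with the head as the top symbol. A transition
`(q, x, a, r, β)` may be taken when the machine is in state `q` with `x` on top
of the stack, whereupon it scans `a` (or nothing if `a = none`), moves to state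
`r`, and replaces `x` by the string `β` on the stack. -/
structure PDA (α : Type) where
  /-- states -/
  Q : Type
  /-- stack alphabet -/
  Γ : Type
  [finQ : Fintype Q]
  [finΓ : Fintype Γ]
  /-- start state -/
  q0 : Q
  /-- accept states -/
  F : Set Q
  /-- bottom stack symbol -/
  bot : Γ
  /-- transitions -/
  δ : Set (Q × Γ × Option α × Q × List Γ)

attribute [instance] PDA.finQ PDA.finΓ

namespace PDA

variable {α : Type}

/-- `P.Steps c w c'` means the PDA `P` can go from configuration `c` to
configuration `c'` while reading exactly the input string `w`. -/
inductive Steps (P : PDA α) :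
    (P.Q × List P.Γ) → List α → (P.Q × List P.Γ) → Prop
  | refl (c : P.Q × List P.Γ) : Steps P c [] c
  | scan {q : P.Q} {x : P.Γ} {a : α} {r : P.Q} {β s : List P.Γ} {w : List α}
      {c : P.Q × List P.Γ} :
      (q, x, some a, r, β) ∈ P.δ → Steps P (r, β ++ s) w c →
      Steps P (q, x :: s) (a :: w) c
  | eps {q : P.Q} {x : P.Γ} {r : P.Q} {β s : List P.Γ} {w : List α}
      {c : P.Q × List P.Γ} :
      (q, x, none, r, β) ∈ P.δ → Steps P (r, β ++ s) w c →
      Steps P (q, x :: s) w c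

/-- The PDA accepts `w` iff some run reading exactly `w` from the start state
with stack `[⊥]` terminates in an accept state with `⊥` on top of the stack. -/
def Accepts (P : PDA α) (w : List α) : Prop :=
  ∃ (q : P.Q) (s : List P.Γ), q ∈ P.F ∧ P.Steps (P.q0, [P.bot]) w (q, P.bot :: s)

/-- The language recognized by the PDA. -/
def language (P : PDA α) : Language α := {w | P.Accepts w}

/-- A PDA is *restricted* if all of its transitions scan an input symbol and
have one of the forms `(q, x, a, r, xy)` (push `y` on top of `x`),
`(q, x, a, r, y)` (replace `x` with `y`), or `(q, x, a, r, ε)` (pop `x`). -/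
def Restricted (P : PDA α) : Prop :=
  ∀ t ∈ P.δ, ∃ (q : P.Q) (x : P.Γ) (a : α) (r : P.Q) (β : List P.Γ),
    t = (q, x, some a, r, β) ∧
      ((∃ y : P.Γ, β = [y, x]) ∨ (∃ y : P.Γ, β = [y]) ∨ β = [])

/-- A PDA is *almost restricted* if all of its transitions scan an input symbol
and have one of the forms `(q, x, a, r, x y₁ ⋯ y_k)` (push the string
`y₁ ⋯ y_k` on top of `x`), `(q, x, a, r, y)` (replace `x` with `y`), or
`(q, x, a, r, ε)` (pop `x`). -/
def AlmostRestricted (P : PDA α) : Prop :=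
  ∀ t ∈ P.δ, ∃ (q : P.Q) (x : P.Γ) (a : α) (r : P.Q) (β : List P.Γ),
    t = (q, x, some a, r, β) ∧
      ((∃ ys : List P.Γ, β = ys ++ [x]) ∨ (∃ y : P.Γ, β = [y]) ∨ β = [])

end PDA


open scoped Classical

/-- Restricted-form PDA transitions: push a symbol on top of the current top symbol,
replace the top symbol, or pop the top symbol. -/
inductive RTransition (Q Γ : Type) where
  | push (q : Q) (x : Γ) (r : Q) (y : Γ)
  | replace (q : Q) (x : Γ) (r : Q) (y : Γ)
  | pop (q : Q) (x : Γ) (r : Q)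
  deriving DecidableEq, Fintype

/-- Apply a restricted transition to a configuration (state, stack with head = top). -/
def RTransition.apply {Q Γ : Type} [DecidableEq Q] [DecidableEq Γ] :
    RTransition Q Γ → Q × List Γ → Option (Q × List Γ)
  | .push q x r y, (q', x' :: s) =>
      if q = q' ∧ x = x' then some (r, y :: x' :: s) else none
  | .replace q x r y, (q', x' :: s) =>
      if q = q' ∧ x = x' then some (r, y :: s) else none
  | .pop q x r, (q', x' :: s) =>
      if q = q' ∧ x = x' then some (r, s) else none
  | _, (_, []) => none

/-- Execute a run (sequence of transitions) from the initial configuration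
(start state `q0`, stack `[⊥]`). -/
def execRun {Q Γ : Type} [DecidableEq Q] [DecidableEq Γ] (q0 : Q) (bot : Γ)
    (π : List (RTransition Q Γ)) : Option (Q × List Γ) :=
  π.foldl (fun c τ => c.bind τ.apply) (some (q0, [bot]))

/-- The run `π` is valid and ends in state `r` with `y` on top of the stack. -/
def runEndsAt {Q Γ : Type} [DecidableEq Q] [DecidableEq Γ] (q0 : Q) (bot : Γ)
    (π : List (RTransition Q Γ)) (r : Q) (y : Γ) : Bool :=
  match execRun q0 bot π with
  | some (r', y' :: _) => decide (r = r' ∧ y = y')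
  | _ => false

/-- Logistic sigmoid extended to `ℝ ∪ {-∞, +∞}`. -/
noncomputable def esigmoid (x : EReal) : ℝ :=
  if x = ⊥ then 0 else if x = ⊤ then 1 else 1 / (1 + Real.exp (-x.toReal))

/-- Hyperbolic tangent extended to `ℝ ∪ {-∞, +∞}`. -/
noncomputable def etanh (x : EReal) : ℝ :=
  if x = ⊥ then -1 else if x = ⊤ then 1 else Real.tanh x.toReal

/-- Exponential function from `ℝ ∪ {-∞, +∞}` to `[0, ∞]`. -/
noncomputable def eexp (x : EReal) : ENNReal :=
  if x = ⊥ then 0 else if x = ⊤ then ⊤ else ENNReal.ofReal (Real.exp x.toReal)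

/-- Affine map with weights and bias in `ℝ ∪ {-∞, +∞}` applied to a real vector. -/
noncomputable def eaffine {ι : Type} [Fintype ι] (W : ι → EReal) (b : EReal)
    (v : ι → ℝ) : EReal :=
  (∑ i, W i * ((v i : ℝ) : EReal)) + b

/-- A renormalizing nondeterministic stack RNN (RNS-RNN): an LSTM controller
(with parameters allowed to take values in `ℝ ∪ {-∞, +∞}`) coupled to a
differentiable simulation of a real-time nondeterministic PDA with states `Q`,
stack alphabet `Γ`, start state `q0`, and bottom stack symbol `bot`. -/
structure RNSRNN (ι : Type) where
  Q : Type
  Γ : Type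
  [finQ : Fintype Q]
  [decQ : DecidableEq Q]
  [finΓ : Fintype Γ]
  [decΓ : DecidableEq Γ]
  q0 : Q
  bot : Γ
  /-- input embedding dimension -/
  dIn : ℕ
  /-- hidden dimension -/
  d : ℕ
  /-- embedding of input symbols -/
  embed : ι → Fin dIn → ℝ
  /-- input gate weights (input = x_t ⊕ stack reading r_{t-1} ⊕ hidden h_{t-1}) -/
  Wi : Fin d → (Fin dIn ⊕ (Q × Γ)) ⊕ Fin d → EReal
  bi : Fin d → EReal
  Wf : Fin d → (Fin dIn ⊕ (Q × Γ)) ⊕ Fin d → EReal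
  bf : Fin d → EReal
  Wg : Fin d → (Fin dIn ⊕ (Q × Γ)) ⊕ Fin d → EReal
  bg : Fin d → EReal
  Wo : Fin d → (Fin dIn ⊕ (Q × Γ)) ⊕ Fin d → EReal
  bo : Fin d → EReal
  /-- affine map producing the PDA transition weights Δ[t] = exp(affine(h_t)) -/
  Wa : RTransition Q Γ → Fin d → EReal
  ba : RTransition Q Γ → EReal

attribute [instance] RNSRNN.finQ RNSRNN.decQ RNSRNN.finΓ RNSRNN.decΓ

namespace RNSRNN

/-- Weight `ψ(π) = ∏ᵢ Δ[i][τᵢ]` of a run, given the history of transition weights. -/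
noncomputable def runWeight {Q Γ : Type} (deltas : List (RTransition Q Γ → ENNReal))
    (π : List (RTransition Q Γ)) : ENNReal :=
  (List.zipWith (fun Δ τ => Δ τ) deltas π).prod

/-- Total weight of all runs of length `t = deltas.length` ending in state `r`
with `y` on top of the stack. -/
noncomputable def readingNum {Q Γ : Type} [Fintype Q] [Fintype Γ]
    [DecidableEq Q] [DecidableEq Γ] (q0 : Q) (bot : Γ)
    (deltas : List (RTransition Q Γ → ENNReal)) (r : Q) (y : Γ) : ENNReal :=
  ∑ π : Fin deltas.length → RTransition Q Γ,
    if runEndsAt q0 bot (List.ofFn π) r y then runWeight deltas (List.ofFn π) else 0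

/-- The stack reading: the renormalized marginal distribution over pairs
(current PDA state, top stack symbol). -/
noncomputable def reading {Q Γ : Type} [Fintype Q] [Fintype Γ]
    [DecidableEq Q] [DecidableEq Γ] (q0 : Q) (bot : Γ)
    (deltas : List (RTransition Q Γ → ENNReal)) : Q × Γ → ℝ :=
  fun p =>
    (readingNum q0 bot deltas p.1 p.2 /
      ∑ p' : Q × Γ, readingNum q0 bot deltas p'.1 p'.2).toReal

variable {ι : Type}

/-- One timestep of the RNS-RNN: the LSTM controller reads the input symbol and the
previous stack reading, updates `(h, c)` by the standard LSTM equations, and emits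
the new PDA transition weights `Δ[t] = exp(affine(h_t))`. The carried state is
`(h_t, c_t, [Δ[1], …, Δ[t]])`. -/
noncomputable def step (net : RNSRNN ι)
    (st : (Fin net.d → ℝ) × (Fin net.d → ℝ) × List (RTransition net.Q net.Γ → ENNReal))
    (a : ι) :
    (Fin net.d → ℝ) × (Fin net.d → ℝ) × List (RTransition net.Q net.Γ → ENNReal) :=
  let rprev : net.Q × net.Γ → ℝ := reading net.q0 net.bot st.2.2
  let inp : (Fin net.dIn ⊕ (net.Q × net.Γ)) ⊕ Fin net.d → ℝ :=
    Sum.elim (Sum.elim (net.embed a) rprev) st.1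
  let iGate : Fin net.d → ℝ := fun j => esigmoid (eaffine (net.Wi j) (net.bi j) inp)
  let fGate : Fin net.d → ℝ := fun j => esigmoid (eaffine (net.Wf j) (net.bf j) inp)
  let gGate : Fin net.d → ℝ := fun j => etanh (eaffine (net.Wg j) (net.bg j) inp)
  let oGate : Fin net.d → ℝ := fun j => esigmoid (eaffine (net.Wo j) (net.bo j) inp)
  let c' : Fin net.d → ℝ := fun j => fGate j * st.2.1 j + iGate j * gGate j
  let h' : Fin net.d → ℝ := fun j => oGate j * Real.tanh (c' j)
  let Δ : RTransition net.Q net.Γ → ENNReal :=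
    fun τ => eexp (eaffine (net.Wa τ) (net.ba τ) h')
  (h', c', st.2.2 ++ [Δ])

/-- Run the RNS-RNN on an input string, starting from `h₀ = c₀ = 0`. -/
noncomputable def run (net : RNSRNN ι) (w : List ι) :
    (Fin net.d → ℝ) × (Fin net.d → ℝ) × List (RTransition net.Q net.Γ → ENNReal) :=
  w.foldl net.step (0, 0, [])

/-- Output of an MLP layer `y = σ(W₂ σ(W₁ h_{|w|} + b₁) + b₂)` applied to the final
hidden state after reading `w`. -/
noncomputable def output (net : RNSRNN ι) {m : ℕ} (W₁ : Fin m → Fin net.d → EReal)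
    (b₁ : Fin m → EReal) (W₂ : Fin m → EReal) (b₂ : EReal) (w : List ι) : ℝ :=
  esigmoid (eaffine W₂ b₂ (fun j => esigmoid (eaffine (W₁ j) (b₁ j) (net.run w).1)))

/-- The RNS-RNN `net` (over the alphabet extended with an end-of-sequence symbol
`none = EOS`) recognizes the language `L`: there is an MLP layer such that, after
reading `w · EOS`, the output `y` satisfies `y > 1/2` iff `w ∈ L`. -/
def Recognizes {σA : Type} (net : RNSRNN (Option σA)) (L : Language σA) : Prop :=
  ∃ (m : ℕ) (W₁ : Fin m → Fin net.d → EReal) (b₁ : Fin m → EReal)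
    (W₂ : Fin m → EReal) (b₂ : EReal),
    ∀ w : List σA,
      1 / 2 < net.output W₁ b₁ W₂ b₂ (w.map some ++ [none]) ↔ w ∈ L

end RNSRNN

/-- Interpret a restricted-form RNS-RNN transition as a PDA transition scanning
the input symbol `a` (mapping states and stack symbols along the given maps). -/
def RTransition.toPDATransition {Q Γ Q' Γ' α : Type} (eQ : Q → Q') (eΓ : Γ → Γ')
    (a : α) : RTransition Q Γ → Q' × Γ' × Option α × Q' × List Γ'
  | .push q x r y => (eQ q, eΓ x, some a, eQ r, [eΓ y, eΓ x])
  | .replace q x r y => (eQ q, eΓ x, some a, eQ r, [eΓ y])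
  | .pop q x r => (eQ q, eΓ x, some a, eQ r, [])

lemma Finset.sum_ite_idempotent {κ : Type} (s : Finset κ) (p : κ → Prop)
    [DecidablePred p] (z : EReal)
    (hz : z + z = z) :
    ∑ i ∈ s, (if p i then z else 0) = if ∃ i ∈ s, p i then z else 0 := by
  induction s using Finset.induction_on with
  | empty => simp
  | insert a s ha ih =>
    rw [Finset.sum_insert ha, ih]
    by_cases h1 : p a <;> by_cases h2 : ∃ i ∈ s, p i <;> simp [h1, h2, hz]

/-- An affine map whose weights are all `0` or a fixed infinity `z` detects whether some
coordinate in the support is positive. -/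
lemma eaffine_indicator {κ : Type} [Fintype κ] (S : Set κ) [DecidablePred (· ∈ S)] (z : EReal)
    (hz : z = ⊤ ∨ z = ⊥) (v : κ → ℝ) (hv : ∀ i ∈ S, 0 ≤ v i) :
    eaffine (fun i => if i ∈ S then z else 0) 0 v = if ∃ i ∈ S, 0 < v i then z else 0 := by
  have hterm : ∀ i, (if i ∈ S then z else 0) * ((v i : ℝ) : EReal) =
      if i ∈ S ∧ 0 < v i then z else 0 := by
    intro i
    by_cases hi : i ∈ S
    · rcases (hv i hi).eq_or_lt with h | h
      · simp [hi, ← h]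
      · rcases hz with rfl | rfl
        · simp [hi, h, EReal.top_mul_coe_of_pos h]
        · simp [hi, h, EReal.bot_mul_coe_of_pos h]
    · simp [hi]
  have hzz : z + z = z := by rcases hz with rfl | rfl <;> simp
  simp only [eaffine, hterm, add_zero]
  rw [Finset.sum_ite_idempotent _ _ _ hzz]
  simp

lemma eaffine_zero_weights {κ : Type} [Fintype κ] (b : EReal) (v : κ → ℝ) :
    eaffine 0 b v = b := by
  simp [eaffine]

@[simp] lemma esigmoid_top : esigmoid ⊤ = 1 := by simp [esigmoid]

@[simp] lemma esigmoid_bot : esigmoid ⊥ = 0 := by simp [esigmoid]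

@[simp] lemma esigmoid_zero : esigmoid 0 = 1 / 2 := by norm_num [esigmoid]

@[simp] lemma etanh_top : etanh ⊤ = 1 := by simp [etanh]

@[simp] lemma etanh_zero : etanh 0 = 0 := by simp [etanh]

@[simp] lemma eexp_bot : eexp ⊥ = 0 := by simp [eexp]

@[simp] lemma eexp_zero : eexp 0 = 1 := by simp [eexp]

lemma half_lt_esigmoid_coe_iff (x : ℝ) : 1 / 2 < esigmoid (x : EReal) ↔ 0 < x := by
  have hpos : 0 < 1 + Real.exp (-x) := by positivity
  simp only [esigmoid, EReal.coe_ne_bot, EReal.coe_ne_top, if_false, EReal.toReal_coe]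
  rw [div_lt_div_iff₀ two_pos hpos]
  have : Real.exp (-x) < 1 ↔ 0 < x := by rw [Real.exp_lt_one_iff]; simp
  rw [← this]
  constructor <;> intro h <;> linarith

lemma Real.tanh_one_pos : 0 < Real.tanh 1 := by
  rw [Real.tanh_eq_sinh_div_cosh]
  exact div_pos (Real.sinh_pos_iff.2 one_pos) (Real.cosh_pos 1)

lemma runEndsAt_iff {Q Γ : Type} [DecidableEq Q] [DecidableEq Γ] {q0 : Q} {bot : Γ}
    {π : List (RTransition Q Γ)} {r : Q} {y : Γ} :
    runEndsAt q0 bot π r y ↔ ∃ s, execRun q0 bot π = some (r, y :: s) := by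
  unfold runEndsAt
  split
  next r' y' s h => simp [h, eq_comm (a := r), eq_comm (a := y)]
  next h =>
    rw [iff_false_left Bool.false_ne_true]
    rintro ⟨s, hs⟩
    exact h _ _ _ hs

lemma reading_nonneg {Q Γ : Type} [Fintype Q] [Fintype Γ] [DecidableEq Q] [DecidableEq Γ]
    (q0 : Q) (bot : Γ) (deltas : List (RTransition Q Γ → ENNReal)) (p : Q × Γ) :
    0 ≤ RNSRNN.reading q0 bot deltas p :=
  ENNReal.toReal_nonneg

namespace PDA

variable {σA : Type}

/-- The transition `τ`, scanning the symbol `a`, is a transition of `P`. -/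
def Allows (P : PDA σA) (a : σA) (τ : RTransition P.Q P.Γ) : Prop :=
  τ.toPDATransition id id a ∈ P.δ

/-- The transition weights that simulate `P` reading the symbol `a`. -/
noncomputable def weights (P : PDA σA) (a : σA) (τ : RTransition P.Q P.Γ) : ENNReal :=
  if P.Allows a τ then 1 else 0

variable {P : PDA σA}

lemma steps_nil_iff (hP : P.Restricted) (c c' : P.Q × List P.Γ) :
    P.Steps c [] c' ↔ c = c' := by
  constructor
  · intro h
    cases h with
    | refl => rfl
    | eps hδ _ =>
      obtain ⟨q', x', a', r', β', heq, -⟩ := hP _ hδ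
      simp at heq
  · rintro rfl
    exact Steps.refl _

lemma runWeight_weights {w : List σA} {π : List (RTransition P.Q P.Γ)}
    (h : w.length = π.length) :
    RNSRNN.runWeight (w.map P.weights) π = if List.Forall₂ P.Allows w π then 1 else 0 := by
  unfold RNSRNN.runWeight
  induction w generalizing π with
  | nil =>
    obtain rfl : π = [] := List.eq_nil_of_length_eq_zero h.symm
    simp
  | cons a w ih =>
    cases π with
    | nil => simp at h
    | cons τ π =>
      simp only [List.map_cons, List.zipWith_cons_cons, List.prod_cons, List.forall₂_cons]
      rw [ih (by simpa using h)]
      by_cases h1 : P.Allows a τ <;> simp [weights, h1]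

variable [DecidableEq P.Q] [DecidableEq P.Γ]

lemma steps_cons_iff (hP : P.Restricted) (a : σA) (w : List σA) (c c' : P.Q × List P.Γ) :
    P.Steps c (a :: w) c' ↔
      ∃ τ, P.Allows a τ ∧ ∃ c₁, τ.apply c = some c₁ ∧ P.Steps c₁ w c' := by
  constructor
  · intro h
    cases h with
    | @scan q x _ r β s _ _ hδ hs =>
      obtain ⟨q', x', a', r', β', heq, hβ⟩ := hP _ hδ
      simp only [Prod.mk.injEq, Option.some.injEq] at heq
      obtain ⟨rfl, rfl, rfl, rfl, rfl⟩ := heq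
      rcases hβ with ⟨y, rfl⟩ | ⟨y, rfl⟩ | rfl
      · exact ⟨.push q x r y, hδ, _, by simp [RTransition.apply], hs⟩
      · exact ⟨.replace q x r y, hδ, _, by simp [RTransition.apply], hs⟩
      · exact ⟨.pop q x r, hδ, _, by simp [RTransition.apply], hs⟩
    | eps hδ _ =>
      obtain ⟨q', x', a', r', β', heq, -⟩ := hP _ hδ
      simp at heq
  · rintro ⟨τ, hτ, c₁, happ, hs⟩
    obtain ⟨q', s⟩ := c
    cases s with
    | nil => cases τ <;> simp [RTransition.apply] at happ
    | cons x' s =>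
      cases τ <;> simp only [RTransition.apply, Option.ite_none_right_eq_some,
        Option.some.injEq] at happ <;> obtain ⟨⟨rfl, rfl⟩, rfl⟩ := happ <;>
        exact Steps.scan hτ hs

lemma foldl_bind_apply_none (π : List (RTransition P.Q P.Γ)) :
    π.foldl (fun c τ => c.bind τ.apply) (none : Option (P.Q × List P.Γ)) = none := by
  induction π <;> simp_all

lemma steps_iff_exists_run (hP : P.Restricted) (w : List σA) (c c' : P.Q × List P.Γ) :
    P.Steps c w c' ↔ ∃ π : List (RTransition P.Q P.Γ), List.Forall₂ P.Allows w π ∧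
      π.foldl (fun c τ => c.bind τ.apply) (some c) = some c' := by
  induction w generalizing c with
  | nil => simp [steps_nil_iff hP]
  | cons a w ih =>
    rw [steps_cons_iff hP]
    constructor
    · rintro ⟨τ, hτ, c₁, happ, hs⟩
      obtain ⟨π, hπ, hrun⟩ := (ih c₁).1 hs
      exact ⟨τ :: π, .cons hτ hπ, by simpa [happ] using hrun⟩
    · rintro ⟨_, hπ, hrun⟩
      cases hπ with
      | @cons _ τ _ π hτ hπ =>
        rw [List.foldl_cons, Option.bind_some] at hrun
        cases happ : τ.apply c with
        | none => simp [happ, foldl_bind_apply_none] at hrun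
        | some c₁ => exact ⟨τ, hτ, c₁, happ, (ih c₁).2 ⟨π, hπ, happ ▸ hrun⟩⟩

lemma readingNum_weights_ne_top (w : List σA) (r : P.Q) (y : P.Γ) :
    RNSRNN.readingNum P.q0 P.bot (w.map P.weights) r y ≠ ⊤ := by
  unfold RNSRNN.readingNum
  refine ENNReal.sum_ne_top.2 fun π _ => ?_
  rw [runWeight_weights (by simp)]
  split_ifs <;> simp

lemma readingNum_weights_ne_zero_iff (w : List σA) (r : P.Q) (y : P.Γ) :
    RNSRNN.readingNum P.q0 P.bot (w.map P.weights) r y ≠ 0 ↔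
      ∃ π, List.Forall₂ P.Allows w π ∧ ∃ s, execRun P.q0 P.bot π = some (r, y :: s) := by
  unfold RNSRNN.readingNum
  simp only [ne_eq, Finset.sum_eq_zero_iff, Finset.mem_univ, true_imp_iff, not_forall,
    ← runEndsAt_iff]
  constructor
  · rintro ⟨π, hπ⟩
    rw [runWeight_weights (by simp)] at hπ
    refine ⟨List.ofFn π, ?_⟩
    by_contra h
    apply hπ
    split_ifs <;> simp_all
  · rintro ⟨π, hπ, hend⟩
    have hofFn : ∀ n, π.length = n → ∃ f : Fin n → RTransition P.Q P.Γ, List.ofFn f = π := by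
      rintro _ rfl
      exact ⟨π.get, List.ofFn_get π⟩
    obtain ⟨f, hf⟩ := hofFn (w.map P.weights).length (by simp [hπ.length_eq])
    refine ⟨f, ?_⟩
    rw [hf, runWeight_weights hπ.length_eq]
    simp [hπ, hend]

lemma reading_weights_pos_iff (w : List σA) (p : P.Q × P.Γ) :
    0 < RNSRNN.reading P.q0 P.bot (w.map P.weights) p ↔
      RNSRNN.readingNum P.q0 P.bot (w.map P.weights) p.1 p.2 ≠ 0 := by
  unfold RNSRNN.reading
  rw [ENNReal.toReal_pos_iff]
  have htop := readingNum_weights_ne_top (P := P) w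
  constructor
  · rintro ⟨h, -⟩ h0
    simp [h0] at h
  · intro h
    refine ⟨ENNReal.div_pos h (ENNReal.sum_ne_top.2 fun _ _ => htop _ _),
      ENNReal.div_lt_top (htop _ _) fun h0 => h ?_⟩
    exact Finset.sum_eq_zero_iff.1 h0 p (Finset.mem_univ p)

lemma accepts_iff_reading_pos (hP : P.Restricted) (w : List σA) :
    P.Accepts w ↔ ∃ q ∈ P.F,
      0 < RNSRNN.reading P.q0 P.bot (w.map P.weights) (q, P.bot) := by
  simp only [reading_weights_pos_iff, readingNum_weights_ne_zero_iff, Accepts,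
    steps_iff_exists_run hP, execRun]
  constructor
  · rintro ⟨q, s, hq, π, hπ, h⟩
    exact ⟨q, hq, π, hπ, s, h⟩
  · rintro ⟨q, hq, π, hπ, s, h⟩
    exact ⟨q, s, hq, π, hπ, h⟩

end PDA

namespace PDA

variable {σA : Type} [Fintype σA] (P : PDA σA)

/-- An indexing of the symbols, including EOS, by which both the one-hot input coordinates and
the hidden units of the simulating network are numbered. -/
noncomputable def unit (σA : Type) [Fintype σA] :
    Option σA ≃ Fin (Fintype.card (Option σA)) :=
  Fintype.equivFin _

/-- The controller inputs that a hidden unit listens to: the unit of a symbol listens to the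
one-hot coordinate of that symbol, and the EOS unit to the readings of accepting
configurations. -/
def unitSupport : Option σA →
    Set ((Fin (Fintype.card (Option σA)) ⊕ (P.Q × P.Γ)) ⊕ Fin (Fintype.card (Option σA)))
  | some a => {.inl (.inl (unit σA (some a)))}
  | none => {i | ∃ q ∈ P.F, i = .inl (.inr (q, P.bot))}

/-- The hidden units of the symbols that do not enable the transition `τ`. -/
def blockers (τ : RTransition P.Q P.Γ) : Set (Fin (Fintype.card (Option σA))) :=
  {j | ∃ a, j = unit σA (some a) ∧ ¬ P.Allows a τ}

/-- The RNS-RNN that simulates `P`. -/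
noncomputable abbrev simulator : RNSRNN (Option σA) where
  Q := P.Q
  Γ := P.Γ
  q0 := P.q0
  bot := P.bot
  dIn := Fintype.card (Option σA)
  d := Fintype.card (Option σA)
  embed a k := if k = unit σA a then 1 else 0
  Wi _ := 0
  bi _ := ⊤
  Wf _ := 0
  bf _ := ⊥
  Wg j i := if i ∈ P.unitSupport ((unit σA).symm j) then ⊤ else 0
  bg _ := 0
  Wo _ := 0
  bo _ := ⊤
  Wa τ j := if j ∈ P.blockers τ then ⊥ else 0
  ba _ := 0

lemma simulator_hidden (st) (o u : Option σA) :
    (P.simulator.step st o).1 (unit σA u) =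
      if ∃ i ∈ P.unitSupport u, 0 < Sum.elim (Sum.elim (P.simulator.embed o)
        (RNSRNN.reading P.simulator.q0 P.simulator.bot st.2.2)) st.1 i
      then Real.tanh 1 else 0 := by
  have hg : eaffine (P.simulator.Wg (unit σA u)) 0 (Sum.elim (Sum.elim (P.simulator.embed o)
      (RNSRNN.reading P.simulator.q0 P.simulator.bot st.2.2)) st.1) = _ :=
    eaffine_indicator (P.unitSupport ((unit σA).symm (unit σA u))) ⊤ (.inl rfl) _ (by
      rw [Equiv.symm_apply_apply]
      cases u with
      | some a =>
        rintro _ rfl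
        simp only [Sum.elim_inl, simulator]
        split_ifs <;> simp
      | none =>
        rintro _ ⟨q, -, rfl⟩
        exact reading_nonneg _ _ _ _)
  rw [Equiv.symm_apply_apply] at hg
  change esigmoid (eaffine 0 ⊤ _) * Real.tanh (esigmoid (eaffine 0 ⊥ _) * _ +
    esigmoid (eaffine 0 ⊤ _) * etanh (eaffine (P.simulator.Wg (unit σA u)) 0 _)) = _
  rw [eaffine_zero_weights, eaffine_zero_weights, hg]
  split_ifs <;> simp

lemma simulator_hidden_some (st) (o : Option σA) (a : σA) :
    (P.simulator.step st o).1 (unit σA (some a)) = if o = some a then Real.tanh 1 else 0 := by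
  rw [simulator_hidden]
  have : (∃ i ∈ P.unitSupport (some a), 0 < Sum.elim (Sum.elim (P.simulator.embed o)
      (RNSRNN.reading P.simulator.q0 P.simulator.bot st.2.2)) st.1 i) ↔ o = some a := by
    simp only [unitSupport, Set.mem_singleton_iff, exists_eq_left, Sum.elim_inl, simulator,
      EmbeddingLike.apply_eq_iff_eq]
    by_cases h : some a = o <;> simp [h, eq_comm (a := o)]
  simp only [this]

lemma simulator_step_weights (st) (a : σA) :
    (P.simulator.step st (some a)).2.2 = st.2.2 ++ [P.weights a] := by
  change st.2.2 ++ [fun τ => eexp (eaffine (P.simulator.Wa τ) 0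
    (P.simulator.step st (some a)).1)] = _
  congr 2
  funext τ
  have hτ : eaffine (P.simulator.Wa τ) 0 (P.simulator.step st (some a)).1 = _ :=
    eaffine_indicator (P.blockers τ) ⊥ (.inr rfl) _ (by
      rintro _ ⟨b, rfl, -⟩
      rw [simulator_hidden_some]
      split_ifs
      exacts [Real.tanh_one_pos.le, le_rfl])
  have hex : (∃ j ∈ P.blockers τ, 0 < (P.simulator.step st (some a)).1 j) ↔
      ¬ P.Allows a τ := by
    constructor
    · rintro ⟨_, ⟨b, rfl, hb⟩, hpos⟩
      rw [simulator_hidden_some] at hpos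
      by_cases hab : a = b
      · rwa [hab]
      · simp [hab] at hpos
    · intro h
      refine ⟨_, ⟨a, rfl, h⟩, ?_⟩
      rw [simulator_hidden_some]
      simpa using Real.tanh_one_pos
  rw [hτ, weights]
  by_cases h : P.Allows a τ <;> simp [hex, h]

lemma simulator_run_weights (w : List σA) :
    (P.simulator.run (w.map some)).2.2 = w.map P.weights := by
  induction w using List.reverseRecOn with
  | nil => rfl
  | append_singleton w a ih =>
    rw [RNSRNN.run] at ih ⊢
    rw [List.map_append, List.foldl_append, List.map_append, ← ih]
    exact P.simulator_step_weights _ a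

lemma simulator_run_eos (w : List σA) :
    P.simulator.run (w.map some ++ [none]) =
      P.simulator.step (P.simulator.run (w.map some)) none := by
  simp [RNSRNN.run]

lemma simulator_hidden_none (hP : P.Restricted) (w : List σA) :
    (P.simulator.run (w.map some ++ [none])).1 (unit σA none) =
      if P.Accepts w then Real.tanh 1 else 0 := by
  rw [simulator_run_eos, simulator_hidden, simulator_run_weights]
  have : (∃ i ∈ P.unitSupport none, 0 < Sum.elim (Sum.elim (P.simulator.embed none)
      (RNSRNN.reading P.simulator.q0 P.simulator.bot (w.map P.weights)))
      (P.simulator.run (w.map some)).1 i) ↔ P.Accepts w := by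
    rw [accepts_iff_reading_pos hP]
    constructor
    · rintro ⟨_, ⟨q, hq, rfl⟩, h⟩
      exact ⟨q, hq, h⟩
    · rintro ⟨q, hq, h⟩
      exact ⟨_, ⟨q, hq, rfl⟩, h⟩
  simp only [this]

lemma simulator_recognizes (hP : P.Restricted) : P.simulator.Recognizes P.language := by
  refine ⟨1, fun _ j => if j ∈ ({unit σA none} : Set _) then ⊤ else 0, fun _ => 0,
    fun _ => 1, ((-(1 / 2) : ℝ) : EReal), fun w => ?_⟩
  have hnn : 0 ≤ (P.simulator.run (w.map some ++ [none])).1 (unit σA none) := by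
    rw [simulator_hidden_none P hP]
    split_ifs
    exacts [Real.tanh_one_pos.le, le_rfl]
  have hin : eaffine (fun j => if j ∈ ({unit σA none} : Set _) then (⊤ : EReal) else 0) 0
      (P.simulator.run (w.map some ++ [none])).1 = if P.Accepts w then ⊤ else 0 := by
    rw [eaffine_indicator {unit σA none} ⊤ (.inl rfl) _ (by rintro _ rfl; exact hnn)]
    simp only [Set.mem_singleton_iff, exists_eq_left]
    rw [simulator_hidden_none P hP]
    by_cases h : P.Accepts w <;> simp [h, Real.tanh_one_pos]
  have hout : ∀ x : ℝ, eaffine (fun _ : Fin 1 => (1 : EReal)) ((-(1 / 2) : ℝ) : EReal)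
      (fun _ => x) = ((x + -(1 / 2) : ℝ) : EReal) := by
    intro x
    rw [EReal.coe_add]
    simp [eaffine]
  unfold RNSRNN.output
  beta_reduce
  rw [hin, hout, half_lt_esigmoid_coe_iff]
  change _ ↔ P.Accepts w
  by_cases h : P.Accepts w <;> simp [h]
  norm_num

end PDA

/-- **Lemma.** For any restricted-form PDA `P` that recognizes a language `L`,
there is an RNS-RNN (with parameters allowed to take values in `ℝ ∪ {-∞, +∞}`)
that recognizes `L`. Moreover, the controller emits, at each timestep, weight 1
for exactly the transitions of `P` that scan the current input symbol and weight
0 for all others, and an MLP layer on the final hidden state after reading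
`w · EOS` outputs `y > 1/2` iff `w ∈ L`. -/
theorem rnsrnn_recognizes_of_restricted_pda {σA : Type} [Fintype σA]
    (P : PDA σA) (hP : P.Restricted) (L : Language σA) (hL : P.language = L) :
    ∃ (net : RNSRNN (Option σA)) (eQ : net.Q ≃ P.Q) (eΓ : net.Γ ≃ P.Γ),
      net.Recognizes L ∧
      ∀ (w : List σA) (t : ℕ) (ht : t < w.length)
        (τ : RTransition net.Q net.Γ),
        ((net.run (w.map some ++ [none])).2.2.getD t (fun _ => 0)) τ =
          if τ.toPDATransition eQ eΓ (w.get ⟨t, ht⟩) ∈ P.δ then 1 else 0 := by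
  subst hL
  refine ⟨P.simulator, Equiv.refl _, Equiv.refl _, P.simulator_recognizes hP, ?_⟩
  intro w t ht τ
  rw [P.simulator_run_eos]
  change ((P.simulator.run (w.map some)).2.2 ++ [_]).getD t _ τ = _
  rw [P.simulator_run_weights, List.getD_append _ _ _ _ (by simpa using ht)]
  simp [ht, PDA.weights, PDA.Allows]
  rfl
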